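/- arXiv:2405.06292 — 6 statements merged into one kernel-verified Lean document; each statement's English description precedes it below -/
import Mathlib

section
/- Let A be an s×s non-singular by columns (NSC) Toeplitz matrix over the finite field F_q, where q = p^h. Then for every integer 0 ≤ e ≤ h−1, the matrix π_e(A)^{-1}·Q is NSC (note that an NSC matrix is invertible, and π_e(A) is again NSC, hence invertible). -/
open Matrix Finset Kronecker

variable {F : Type} [Field F] [DecidableEq F]

/-- Entrywise application of the map `π_e : x ↦ x ^ (p ^ e)` to a matrix. -/
def piE (p e : ℕ) {m n : Type} (A : Matrix m n F) : Matrix m n F :=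
  A.map fun x => x ^ p ^ e

/-- Entrywise application of `π_e` to a vector. -/
def piEv (p e : ℕ) {n : Type} (v : n → F) : n → F := fun i => v i ^ p ^ e

/-- A monomial matrix: exactly one nonzero entry in each row and each column. -/
def IsMonomial {n : Type} [Fintype n] (M : Matrix n n F) : Prop :=
  (∀ i, ∃! j, M i j ≠ 0) ∧ (∀ j, ∃! i, M i j ≠ 0)

/-- Non-singular by columns (NSC): for each `ℓ`, every `ℓ × ℓ` submatrix formed by the first
`ℓ` rows and any `ℓ` columns (in increasing order) is non-singular. -/
def IsNSC {s : ℕ} (A : Matrix (Fin s) (Fin s) F) : Prop :=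
  ∀ (ℓ : ℕ) (hℓ : ℓ ≤ s) (j : Fin ℓ → Fin s), StrictMono j →
    (Matrix.of fun a b : Fin ℓ => A (Fin.castLE hℓ a) (j b)).det ≠ 0

/-- Toeplitz matrix: constant along diagonals. -/
def IsToeplitz {s : ℕ} (A : Matrix (Fin s) (Fin s) F) : Prop :=
  ∀ (i j : ℕ) (hi : i + 1 < s) (hj : j + 1 < s),
    A ⟨i, Nat.lt_of_succ_lt hi⟩ ⟨j, Nat.lt_of_succ_lt hj⟩ = A ⟨i + 1, hi⟩ ⟨j + 1, hj⟩

/-- The anti-diagonal matrix `Q` with ones on the anti-diagonal. -/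
def antiDiagQ (F : Type) [Field F] (s : ℕ) : Matrix (Fin s) (Fin s) F :=
  Matrix.of fun i j => if (i : ℕ) + (j : ℕ) + 1 = s then 1 else 0

/-- Dual of a code with respect to the pairing `⟨u, c⟩ = ∑ j, u j * g c j`. -/
def dualWith {n : Type} [Fintype n] (g : (n → F) → n → F) (C : Submodule F (n → F)) :
    Submodule F (n → F) where
  carrier := {u | ∀ c ∈ C, ∑ j, u j * g c j = 0}
  add_mem' := by
    intro a b ha hb c hc
    simp only [Pi.add_apply, add_mul, Finset.sum_add_distrib, ha c hc, hb c hc, add_zero]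
  zero_mem' := by
    intro c hc
    simp
  smul_mem' := by
    intro r a ha c hc
    simp only [Pi.smul_apply, smul_eq_mul, mul_assoc, ← Finset.mul_sum, ha c hc, mul_zero]

/-- The `σ = (M, e)` dual of a linear code. -/
def sigmaDual {n : Type} [Fintype n] (p e : ℕ) (M : Matrix n n F)
    (C : Submodule F (n → F)) : Submodule F (n → F) :=
  dualWith (fun c => Matrix.vecMul (piEv p e c) M) C

/-- The Euclidean dual of a linear code. -/
def euclidDual {n : Type} [Fintype n] (C : Submodule F (n → F)) : Submodule F (n → F) :=
  dualWith id C

/-- The matrix-product code `[C_1, …, C_s] · A`, realized inside `Fin s × Fin n → F`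
(block `j` of a codeword is `∑ i, A i j • c i`). -/
def matrixProductCode {n s : ℕ} (C : Fin s → Submodule F (Fin n → F))
    (A : Matrix (Fin s) (Fin s) F) : Submodule F (Fin s × Fin n → F) where
  carrier := {x | ∃ c : Fin s → Fin n → F, (∀ i, c i ∈ C i) ∧
    ∀ jt : Fin s × Fin n, x jt = ∑ i, A i jt.1 * c i jt.2}
  add_mem' := by
    rintro x y ⟨c, hc, hx⟩ ⟨d, hd, hy⟩
    refine ⟨c + d, fun i => (C i).add_mem (hc i) (hd i), fun jt => ?_⟩
    simp [hx jt, hy jt, mul_add, Finset.sum_add_distrib]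
  zero_mem' := ⟨0, fun i => (C i).zero_mem, fun jt => by simp⟩
  smul_mem' := by
    rintro r x ⟨c, hc, hx⟩
    refine ⟨r • c, fun i => (C i).smul_mem r (hc i), fun jt => ?_⟩
    simp [hx jt, Finset.mul_sum, mul_left_comm]

/-- The minimum distance of the code `C` is at least `d`. -/
def minDistGe {n : Type} [Fintype n] (C : Submodule F (n → F)) (d : ℕ) : Prop :=
  ∀ x ∈ C, x ≠ 0 → d ≤ hammingNorm x

/-- The code `C` has minimum distance exactly `d`. -/
def minDistEq {n : Type} [Fintype n] (C : Submodule F (n → F)) (d : ℕ) : Prop :=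
  minDistGe C d ∧ ∃ x ∈ C, x ≠ 0 ∧ hammingNorm x = d

theorem IsToeplitz.apply_add {F : Type} {s : ℕ} {A : Matrix (Fin s) (Fin s) F}
    (hA : IsToeplitz A) (i j k : ℕ) (hi : i + k < s) (hj : j + k < s) :
    A ⟨i, by lia⟩ ⟨j, by lia⟩ = A ⟨i + k, hi⟩ ⟨j + k, hj⟩ := by
  induction k with
  | zero => rfl
  | succ k ih => exact (ih (by lia) (by lia)).trans (hA (i + k) (j + k) hi hj)

/-- Toeplitz matrices are symmetric about the anti-diagonal. -/
theorem IsToeplitz.apply_rev {F : Type} {s : ℕ} {A : Matrix (Fin s) (Fin s) F}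
    (hA : IsToeplitz A) (i j : Fin s) : A (Fin.rev j) (Fin.rev i) = A i j := by
  rcases le_total (i : ℕ) (Fin.rev j) with h | h
  · have := hA.apply_add i j (Fin.rev j - i : ℕ) (by lia) (by simp [Fin.val_rev]; lia)
    rw [show i = ⟨i, i.2⟩ from rfl, show j = ⟨j, j.2⟩ from rfl]
    refine (this.trans ?_).symm
    congr 1 <;> ext <;> simp [Fin.val_rev] at * <;> lia
  · have := hA.apply_add (Fin.rev j) (Fin.rev i) (i - Fin.rev j : ℕ) (by lia)
      (by simp [Fin.val_rev]; lia)
    refine this.trans ?_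
    congr 1 <;> ext <;> simp [Fin.val_rev] at * <;> lia

theorem IsNSC.det_ne_zero {F : Type} [Field F] {s : ℕ} {A : Matrix (Fin s) (Fin s) F}
    (hA : IsNSC A) : A.det ≠ 0 :=
  hA s le_rfl id strictMono_id

/-- Applying a field homomorphism entrywise preserves the NSC property. -/
theorem IsNSC.map {F : Type} [Field F] {s : ℕ} {A : Matrix (Fin s) (Fin s) F}
    (hA : IsNSC A) (f : F →+* F) :
    IsNSC (A.map f) := by
  intro l hl j hj h
  refine hA l hl j hj ((map_eq_zero f).1 ?_)
  rw [RingHom.map_det, ← h]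
  rfl

/-- For an NSC matrix, a combination of the first `m` rows that vanishes on `m` columns
is trivial. -/
theorem IsNSC.eq_zero_of_vecMul {F : Type} [Field F] {s : ℕ} {A : Matrix (Fin s) (Fin s) F}
    (hA : IsNSC A) {m : ℕ} {T : Finset (Fin s)} (hT : T.card = m) (u : Fin s → F)
    (hu : ∀ k : Fin s, m ≤ k → u k = 0) (h : ∀ c ∈ T, (u ᵥ* A) c = 0) : u = 0 := by
  have hm : m ≤ s := by simpa [hT] using T.card_le_univ
  have hv : (fun a : Fin m => u (Fin.castLE hm a)) = 0 := by
    refine eq_zero_of_vecMul_eq_zero (hA m hm (T.orderEmbOfFin hT) (T.orderEmbOfFin hT).strictMono)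
      (funext fun b => ?_)
    rw [Pi.zero_apply, ← h _ (T.orderEmbOfFin_mem hT b)]
    simp only [vecMul, dotProduct, of_apply]
    refine Finset.sum_of_injOn (Fin.castLE hm) (Fin.castLE_injective hm).injOn (by simp)
      (fun k _ hk => ?_) (fun _ _ => rfl)
    rw [hu k, zero_mul]
    by_contra! hlt
    exact hk ⟨⟨k, hlt⟩, by simp, rfl⟩
  funext k
  by_cases hk : (k : ℕ) < m
  · exact congrFun hv ⟨k, hk⟩
  · exact hu k (by lia)

theorem antiDiagQ_mulVec {F : Type} [Field F] {s : ℕ} (y : Fin s → F) (i : Fin s) :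
    (antiDiagQ F s *ᵥ y) i = y (Fin.rev i) := by
  have (j : Fin s) : (i : ℕ) + j + 1 = s ↔ j = Fin.rev i := by
    rw [Fin.ext_iff, Fin.val_rev]; lia
  simp [antiDiagQ, mulVec, dotProduct, this]

/-- The product of the inverse of an NSC Toeplitz matrix with `Q` is NSC. -/
theorem IsNSC.inv_mul_antiDiagQ {F : Type} [Field F] {s : ℕ}
    {B : Matrix (Fin s) (Fin s) F} (hB : IsNSC B)
    (hT : IsToeplitz B) : IsNSC (B⁻¹ * antiDiagQ F s) := by
  intro l hl j hj hdet
  obtain ⟨v, hv, hv0⟩ := exists_mulVec_eq_zero_iff.2 hdet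
  set y : Fin s → F := Function.extend j v 0 with hy
  set w := (B⁻¹ * antiDiagQ F s) *ᵥ y with hw
  have hBw : B *ᵥ w = antiDiagQ F s *ᵥ y := by
    rw [hw, mulVec_mulVec, ← Matrix.mul_assoc, mul_nonsing_inv _ hB.det_ne_zero.isUnit,
      Matrix.one_mul]
  have huy : (w ∘ Fin.rev) ᵥ* B = y := by
    funext c
    have := congrFun hBw (Fin.rev c)
    rw [antiDiagQ_mulVec, Fin.rev_rev] at this
    rw [← this]
    simp only [vecMul, mulVec, dotProduct, Function.comp_apply]
    refine Fintype.sum_equiv Fin.revPerm _ _ fun k => ?_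
    rw [Fin.revPerm_apply, hT.apply_rev, mul_comm]
  have hw0 (a : Fin l) : w (Fin.castLE hl a) = 0 := by
    rw [← Pi.zero_apply (M := fun _ => F) a, ← hv0, hw]
    simp only [mulVec, dotProduct, of_apply]
    refine (Finset.sum_of_injOn j hj.injective.injOn (by simp) (fun k _ hk => ?_)
      (fun b _ => ?_)).symm
    · rw [hy, Function.extend_apply' _ _ _ (by simpa using hk), Pi.zero_apply, mul_zero]
    · rw [hy, hj.injective.extend_apply]
  have hu0 : w ∘ Fin.rev = 0 := by
    refine hB.eq_zero_of_vecMul (m := s - l) (T := (Finset.univ.image j)ᶜ) ?_ _ ?_ ?_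
    · rw [Finset.card_compl, Finset.card_image_of_injective _ hj.injective]
      simp
    · intro k hk
      exact hw0 ⟨Fin.rev k, by rw [Fin.val_rev]; lia⟩
    · intro c hc
      rw [huy, hy, Function.extend_apply' _ _ _ (by simpa using hc), Pi.zero_apply]
  rw [hu0, zero_vecMul] at huy
  refine hv (funext fun b => ?_)
  rw [← hj.injective.extend_apply v 0 b, ← hy, ← huy]
  rfl

/-- If `A` is an NSC Toeplitz matrix over `F_q`, `q = p^h`, then for every
`0 ≤ e ≤ h - 1` the matrix `π_e(A)⁻¹ · Q` is NSC. -/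
theorem stmt1 {p h : ℕ} (hp : p.Prime) (hh : 0 < h)
    {F : Type} [Field F] [Fintype F] [DecidableEq F] (hcard : Fintype.card F = p ^ h)
    {s : ℕ} (A : Matrix (Fin s) (Fin s) F) (hA : IsNSC A) (hT : IsToeplitz A)
    (e : ℕ) (he : e < h) :
    IsNSC ((piE p e A)⁻¹ * antiDiagQ F s) := by
  have : Fact p.Prime := ⟨hp⟩
  have : CharP F p := charP_of_card_eq_prime_pow hcard
  have hmap : piE p e A = A.map (iterateFrobenius F p e) := rfl
  refine IsNSC.inv_mul_antiDiagQ (hmap ▸ hA.map _) fun i j hi hj => ?_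
  exact congrArg (· ^ p ^ e) (hT i j hi hj)
end

section
/- Let C_1,…,C_s ⊆ F_q^n be linear codes, A an s×s matrix over F_q, and 0 ≤ e ≤ h−1. Let M_{τ'} be an n×n monomial matrix over F_q, M̂ an s×s monomial matrix over F_q, and set M_τ = M̂ ⊗ M_{τ'} (an sn×sn monomial matrix); let σ = (M_τ, e) on F_q^{sn} and σ' = (M_{τ'}, e) on F_q^n. Suppose A·M̂^T·π_e(A)^T = diag(d_1,…,d_s) is diagonal. If for every 1 ≤ i ≤ s either d_i = 0 or C_i is σ' self-orthogonal, then the matrix-product code C(A) = [C_1,…,C_s]·A is σ self-orthogonal. -/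
open Matrix Finset Kronecker

variable {F : Type} [Field F] [DecidableEq F]

/-- For codewords `x`, `y` of matrix-product form, the pairing `⟨x, y⟩_σ` with `σ = (M̂ ⊗ M, e)`
expands in the entries of `A · M̂ᵀ · π_e(A)ᵀ` and the pairings of the constituents. -/
theorem sum_mul_vecMul_piEv_kronecker {F : Type} [Field F] (p e : ℕ) [ExpChar F p] {n s : ℕ}
    (A Mhat : Matrix (Fin s) (Fin s) F) (M : Matrix (Fin n) (Fin n) F)
    (a b : Fin s → Fin n → F) (x y : Fin s × Fin n → F)
    (hx : ∀ jt : Fin s × Fin n, x jt = ∑ i, A i jt.1 * a i jt.2)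
    (hy : ∀ jt : Fin s × Fin n, y jt = ∑ i, A i jt.1 * b i jt.2) :
    ∑ jt, x jt * Matrix.vecMul (piEv p e y) (Mhat ⊗ₖ M) jt =
      ∑ i, ∑ k, (A * Mhatᵀ * (piE p e A)ᵀ) i k *
        ∑ t, a i t * Matrix.vecMul (piEv p e (b k)) M t := by
  have hpow (l : Fin s) (r : Fin n) :
      piEv p e y (l, r) = ∑ k, A k l ^ p ^ e * b k r ^ p ^ e := by
    simp only [piEv, hy, sum_pow_char_pow, mul_pow]
  have hvec (j : Fin s) (t : Fin n) : Matrix.vecMul (piEv p e y) (Mhat ⊗ₖ M) (j, t) =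
      ∑ k, (Mhatᵀ * (piE p e A)ᵀ) j k * Matrix.vecMul (piEv p e (b k)) M t := by
    simp only [Matrix.vecMul, dotProduct, Fintype.sum_prod_type, hpow, kroneckerMap_apply]
    simp only [Matrix.mul_apply, Matrix.transpose_apply, piE, Matrix.map_apply, piEv,
      Finset.sum_mul_sum]
    simp only [Finset.sum_mul]
    rw [Finset.sum_comm (s := (Finset.univ : Finset (Fin s))) (t := (Finset.univ : Finset (Fin s)))]
    refine Finset.sum_congr rfl fun l _ => ?_
    rw [Finset.sum_comm]
    exact Finset.sum_congr rfl fun k _ => Finset.sum_congr rfl fun r _ => by ring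
  rw [Matrix.mul_assoc]
  generalize Mhatᵀ * (piE p e A)ᵀ = N at hvec ⊢
  simp only [Fintype.sum_prod_type, hx, hvec, Matrix.mul_apply, Finset.sum_mul_sum]
  calc
    _ = ∑ j, ∑ i, ∑ k, ∑ t, A i j * a i t * (N j k * Matrix.vecMul (piEv p e (b k)) M t) := by
      refine Finset.sum_congr rfl fun j _ => ?_
      rw [Finset.sum_comm]
      exact Finset.sum_congr rfl fun i _ => Finset.sum_comm
    _ = ∑ i, ∑ k, ∑ j, ∑ t, A i j * a i t * (N j k * Matrix.vecMul (piEv p e (b k)) M t) := by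
      rw [Finset.sum_comm]
      exact Finset.sum_congr rfl fun i _ => Finset.sum_comm
    _ = _ := by
      refine Finset.sum_congr rfl fun i _ => Finset.sum_congr rfl fun k _ =>
        Finset.sum_congr rfl fun j _ => Finset.sum_congr rfl fun t _ => ?_
      ring

/-- if `A · M̂ᵀ · π_e(A)ᵀ = diag(d_1, …, d_s)` and for each `i` either `d_i = 0`
or `C_i` is `σ'` self-orthogonal, then the matrix-product code `[C_1, …, C_s] · A` is
`σ` self-orthogonal, where `σ = (M̂ ⊗ M_{τ'}, e)` and `σ' = (M_{τ'}, e)`. -/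
theorem stmt2 {p h : ℕ} (hp : p.Prime) (hh : 0 < h)
    {F : Type} [Field F] [Fintype F] [DecidableEq F] (hcard : Fintype.card F = p ^ h)
    {n s : ℕ} (C : Fin s → Submodule F (Fin n → F)) (A : Matrix (Fin s) (Fin s) F)
    (e : ℕ) (he : e < h)
    (Mτ' : Matrix (Fin n) (Fin n) F) (hMτ' : IsMonomial Mτ')
    (Mhat : Matrix (Fin s) (Fin s) F) (hMhat : IsMonomial Mhat)
    (d : Fin s → F) (hdiag : A * Mhatᵀ * (piE p e A)ᵀ = Matrix.diagonal d)
    (hC : ∀ i, d i = 0 ∨ C i ≤ sigmaDual p e Mτ' (C i)) :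
    matrixProductCode C A ≤ sigmaDual p e (Mhat ⊗ₖ Mτ') (matrixProductCode C A) := by
  have : Fact p.Prime := ⟨hp⟩
  have : CharP F p := charP_of_card_eq_prime_pow hcard
  rintro x ⟨a, ha, hx⟩ y ⟨b, hb, hy⟩
  rw [sum_mul_vecMul_piEv_kronecker p e A Mhat Mτ' a b x y hx hy, hdiag]
  refine Finset.sum_eq_zero fun i _ => ?_
  rw [Finset.sum_eq_single i (fun k _ hk => by simp [Matrix.diagonal_apply_ne' d hk]) (by simp),
    Matrix.diagonal_apply_eq]
  rcases hC i with hd | hself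
  · rw [hd, zero_mul]
  · rw [hself (ha i) (b i) (hb i), mul_zero]
end

section
/- Let C_1,…,C_s ⊆ F_q^n be linear codes, A a non-singular s×s matrix over F_q, and C(A) = [C_1,…,C_s]·A ⊆ F_q^{sn}. Let 0 ≤ e, e' ≤ h−1 with e' ≡ h − e (mod h), let M_τ and M_{τ'} be sn×sn monomial matrices over F_q, and set σ = (M_τ, e) and σ' = (M_{τ'}, e'). If π_e(M_{τ'}) = t·M_τ^T for some t ∈ F_q^*, then C(A) is σ' dual-containing (i.e., C(A)^{⊥σ'} ⊆ C(A)) if and only if C(A)^{⊥σ'} is σ self-orthogonal (i.e., C(A)^{⊥σ'} ⊆ (C(A)^{⊥σ'})^{⊥σ}). -/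
open Matrix Finset Kronecker

variable {F : Type} [Field F] [DecidableEq F]

theorem IsMonomial.vecMul_surjective {n : Type} [Fintype n] {M : Matrix n n F}
    (hM : IsMonomial M) : Function.Surjective fun x => Matrix.vecMul x M := by
  intro v
  choose c hc huc using hM.1
  choose r hr hur using hM.2
  refine ⟨fun i => v (c i) / M i (c i), ?_⟩
  ext j
  have hcr : c (r j) = j := (huc (r j) j (hr j)).symm
  simp only [Matrix.vecMul, dotProduct]
  rw [Finset.sum_eq_single (r j)]
  · rw [hcr, div_mul_cancel₀ _ (hr j)]
  · intro i _ hi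
    have : M i j = 0 := by
      by_contra h
      exact hi (hur j i h)
    rw [this, mul_zero]
  · simp

theorem exists_vec_orthogonal_of_notMem {n : Type} [Fintype n] [DecidableEq n]
    {C : Submodule F (n → F)} {w : n → F} (hw : w ∉ C) :
    ∃ v : n → F, (∀ c ∈ C, ∑ j, c j * v j = 0) ∧ ∑ j, w j * v j ≠ 0 := by
  obtain ⟨f, hfw, hfC⟩ := Submodule.exists_le_ker_of_notMem hw
  have key : ∀ x : n → F, ∑ j, x j * f (Pi.single j 1) = f x := fun x => by
    conv_rhs => rw [pi_eq_sum_univ' x, map_sum]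
    simp [Pi.single]
  refine ⟨fun j => f (Pi.single j 1), fun c hc => ?_, ?_⟩
  · rw [key]
    exact hfC hc
  · rwa [key]

theorem pow_pow_of_add_mod_eq_zero {p h e e' : ℕ} [Fintype F] (hcard : Fintype.card F = p ^ h)
    (he : e < h) (he' : e' < h) (hee' : e' % h = (h - e) % h) (x : F) :
    (x ^ p ^ e') ^ p ^ e = x := by
  rw [← pow_mul, ← pow_add]
  rcases Nat.eq_zero_or_pos e with rfl | h0
  · have : e' = 0 := by simpa [Nat.mod_eq_of_lt he'] using hee'
    simp [this]
  · rw [Nat.mod_eq_of_lt he', Nat.mod_eq_of_lt (by omega)] at hee'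
    rw [show e' + e = h by omega, ← hcard, FiniteField.pow_card]

theorem sum_mul_vecMul_piEv_pow {p e e' : ℕ} [ExpChar F p] {n : Type} [Fintype n]
    (hpow : ∀ x : F, (x ^ p ^ e') ^ p ^ e = x) {M M' : Matrix n n F} {t : F}
    (hrel : piE p e M' = t • Mᵀ) (u c : n → F) :
    (∑ j, u j * Matrix.vecMul (piEv p e' c) M' j) ^ p ^ e =
      t * ∑ j, c j * Matrix.vecMul (piEv p e u) M j := by
  have hM : ∀ i j, M' i j ^ p ^ e = t * M j i := fun i j => by
    simpa [piE] using congrFun (congrFun hrel i) j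
  simp only [Matrix.vecMul, dotProduct, piEv, sum_pow_char_pow, mul_pow, hpow, hM,
    Finset.mul_sum]
  rw [Finset.sum_comm]
  exact Finset.sum_congr rfl fun _ _ => Finset.sum_congr rfl fun _ _ => by ring

theorem sigmaDual_sigmaDual {p e e' : ℕ} [ExpChar F p] {n : Type} [Fintype n] [DecidableEq n]
    (hpow : ∀ x : F, (x ^ p ^ e') ^ p ^ e = x) {M M' : Matrix n n F} (hM : IsMonomial M)
    {t : F} (ht : t ≠ 0) (hrel : piE p e M' = t • Mᵀ) (C : Submodule F (n → F)) :
    sigmaDual p e M (sigmaDual p e' M' C) = C := by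
  have hpair : ∀ u c : n → F, ∑ j, u j * Matrix.vecMul (piEv p e' c) M' j = 0 ↔
      ∑ j, c j * Matrix.vecMul (piEv p e u) M j = 0 := fun u c => by
    rw [← pow_eq_zero_iff (pow_ne_zero e (expChar_ne_zero F p)),
      sum_mul_vecMul_piEv_pow hpow hrel, mul_eq_zero, or_iff_right ht]
  refine le_antisymm (fun w hw => ?_) fun c hc u hu => (hpair u c).1 (hu c hc)
  by_contra hwC
  obtain ⟨v, hvC, hvw⟩ := exists_vec_orthogonal_of_notMem hwC
  obtain ⟨x, rfl⟩ := hM.vecMul_surjective v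
  have hx : piEv p e (piEv p e' x) = x := funext fun i => hpow (x i)
  refine hvw ?_
  have := hw (piEv p e' x) fun c hc => (hpair _ c).2 (by simpa only [hx] using hvC c hc)
  simpa only [hx] using this

/-- with `e' ≡ h - e (mod h)` and `π_e(M_{τ'}) = t · M_τᵀ` for some `t ≠ 0`,
the matrix-product code `C(A)` is `σ'` dual-containing iff `C(A)^{⊥σ'}` is `σ`
self-orthogonal. -/
theorem stmt3 {p h : ℕ} (hp : p.Prime) (hh : 0 < h)
    {F : Type} [Field F] [Fintype F] [DecidableEq F] (hcard : Fintype.card F = p ^ h)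
    {n s : ℕ} (C : Fin s → Submodule F (Fin n → F))
    (A : Matrix (Fin s) (Fin s) F) (hAdet : IsUnit A.det)
    (e e' : ℕ) (he : e < h) (he' : e' < h) (hee' : e' % h = (h - e) % h)
    (Mτ Mτ' : Matrix (Fin s × Fin n) (Fin s × Fin n) F)
    (hMτ : IsMonomial Mτ) (hMτ' : IsMonomial Mτ')
    (t : F) (ht : t ≠ 0) (hrel : piE p e Mτ' = t • Mτᵀ) :
    sigmaDual p e' Mτ' (matrixProductCode C A) ≤ matrixProductCode C A ↔
      sigmaDual p e' Mτ' (matrixProductCode C A) ≤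
        sigmaDual p e Mτ (sigmaDual p e' Mτ' (matrixProductCode C A)) := by
  have : Fact p.Prime := ⟨hp⟩
  have : CharP F p := charP_of_card_eq_prime_pow hcard
  have : ExpChar F p := ExpChar.prime hp
  rw [sigmaDual_sigmaDual (pow_pow_of_add_mod_eq_zero hcard he he' hee') hMτ ht hrel]
end

section
/- Let q = p^h, 0 ≤ e ≤ h−1, and set r = 2e if 0 ≤ e ≤ h/2 and r = 2e − h if h/2 < e ≤ h−1; let g = gcd(r,h). Suppose A is an s×s non-singular by columns (NSC) matrix over F_q and M_{τ̃} = D_{τ̃}·P_{τ̃} is an s×s monomial matrix over F_q (with D_{τ̃} invertible diagonal and P_{τ̃} a permutation matrix) such that every entry a of A·M_{τ̃} satisfies a^{p^g} = a (i.e., lies in the subfield F_{p^g} of F_q). If all leading principal minors of (A·M_{τ̃})·π_e(A·M_{τ̃})^T are nonzero, then there exists a unit lower triangular s×s matrix L over F_q such that L·A is NSC and (L·A)·M_{σ̂}^T·π_e(L·A)^T is a diagonal matrix with all diagonal entries nonzero, where M_{σ̂} = D_{τ̃}·π_e(D_{τ̃}). -/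
open Matrix Finset Kronecker

variable {F : Type} [Field F] [DecidableEq F]

theorem Fin.sum_univ_eq_sum_castLE {M : Type*} [AddCommMonoid M] {s m : ℕ} (hm : m ≤ s)
    (f : Fin s → M) (hf : ∀ k : Fin s, m ≤ k → f k = 0) :
    ∑ k, f k = ∑ k : Fin m, f (Fin.castLE hm k) := by
  symm
  refine Finset.sum_of_injOn (Fin.castLE hm) (Fin.castLE_injective hm).injOn (by simp) ?_
    fun _ _ => rfl
  intro k _ hk
  refine hf k (not_lt.mp fun hlt => hk ?_)
  exact ⟨⟨k, hlt⟩, by simp, Fin.ext rfl⟩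

/-- The top rows of `L * A`, for `L` lower triangular, only involve the top rows of `A`. -/
theorem Matrix.submatrix_castLE_mul_of_lowerTriangular {K : Type*} [CommRing K] {s m : ℕ}
    {n : Type*} (hm : m ≤ s) {L A : Matrix (Fin s) (Fin s) K} (hL : ∀ i j, i < j → L i j = 0)
    (f : n → Fin s) :
    (L * A).submatrix (Fin.castLE hm) f =
      L.submatrix (Fin.castLE hm) (Fin.castLE hm) * A.submatrix (Fin.castLE hm) f := by
  ext a b
  simp only [Matrix.submatrix_apply, Matrix.mul_apply]
  refine Fin.sum_univ_eq_sum_castLE hm _ fun k hk => ?_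
  rw [hL _ _ (Fin.lt_def.mpr (lt_of_lt_of_le a.isLt hk)), zero_mul]

theorem Matrix.det_eq_one_of_unitLowerTriangular {K : Type*} [CommRing K] {s : ℕ}
    {L : Matrix (Fin s) (Fin s) K} (hL1 : ∀ i, L i i = 1) (hL : ∀ i j, i < j → L i j = 0) :
    L.det = 1 := by
  rw [Matrix.det_of_isLowerTriangular L fun i j hij => hL i j hij]
  simp [hL1]

theorem IsNSC.unitLowerTriangular_mul {K : Type} [Field K] {s : ℕ}
    {L A : Matrix (Fin s) (Fin s) K} (hA : IsNSC A) (hL1 : ∀ i, L i i = 1)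
    (hL : ∀ i j, i < j → L i j = 0) : IsNSC (L * A) := by
  intro m hm f hf
  change ((L * A).submatrix (Fin.castLE hm) f).det ≠ 0
  rw [Matrix.submatrix_castLE_mul_of_lowerTriangular hm hL, Matrix.det_mul,
    Matrix.det_eq_one_of_unitLowerTriangular
      (L := L.submatrix (Fin.castLE hm) (Fin.castLE hm)) (fun i => hL1 _)
      fun i j hij => hL _ _ hij, one_mul]
  exact hA m hm f hf

/-- Gaussian elimination without pivoting: a matrix with nonzero leading principal minors is made
upper triangular by a unit lower triangular matrix. -/
theorem Matrix.exists_unitLowerTriangular_mul_upperTriangular {K : Type*} [Field K] {s : ℕ}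
    (H : Matrix (Fin s) (Fin s) K)
    (hH : ∀ (m : ℕ) (hm : m ≤ s), (H.submatrix (Fin.castLE hm) (Fin.castLE hm)).det ≠ 0) :
    ∃ L : Matrix (Fin s) (Fin s) K, (∀ i, L i i = 1) ∧ (∀ i j, i < j → L i j = 0) ∧
      ∀ i j, j < i → (L * H) i j = 0 := by
  have solve (i : Fin s) : ∃ x : Fin i → K,
      x ᵥ* H.submatrix (Fin.castLE i.isLt.le) (Fin.castLE i.isLt.le) =
        fun j => -H i (Fin.castLE i.isLt.le j) := by
    refine ⟨(fun j => -H i (Fin.castLE i.isLt.le j)) ᵥ*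
      (H.submatrix (Fin.castLE i.isLt.le) (Fin.castLE i.isLt.le))⁻¹, ?_⟩
    rw [Matrix.vecMul_vecMul, Matrix.nonsing_inv_mul _ (hH i i.isLt.le).isUnit,
      Matrix.vecMul_one]
  choose x hx using solve
  let N : Matrix (Fin s) (Fin s) K :=
    Matrix.of fun i j => if hij : j < i then x i ⟨j, hij⟩ else 0
  have hN (i j : Fin s) (hij : i ≤ j) : N i j = 0 := dif_neg hij.not_gt
  refine ⟨N + 1, fun i => ?_, fun i j hij => ?_, fun i j hij => ?_⟩
  · simp [hN i i le_rfl]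
  · simp [hN i j hij.le, hij.ne]
  · have hNH : (N * H) i j = -H i j := by
      rw [Matrix.mul_apply, Fin.sum_univ_eq_sum_castLE i.isLt.le _
        fun k hk => by rw [hN i k hk, zero_mul]]
      refine Eq.trans (Finset.sum_congr rfl fun k _ => ?_) (congrFun (hx i) ⟨j, hij⟩)
      exact congrArg (· * _) (dif_pos (Fin.lt_def.mpr k.isLt))
    rw [add_mul, one_mul, Matrix.add_apply, hNH, neg_add_cancel]

/-- A matrix that is Hermitian with respect to a field endomorphism `σ` and has nonzero leading
principal minors is diagonalized by a unit lower triangular congruence. -/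
theorem Matrix.exists_unitLowerTriangular_congr_diagonal {K : Type*} [Field K] (σ : K →+* K)
    {s : ℕ} (H : Matrix (Fin s) (Fin s) K) (hσ : (H.map σ)ᵀ = H)
    (hH : ∀ (m : ℕ) (hm : m ≤ s), (H.submatrix (Fin.castLE hm) (Fin.castLE hm)).det ≠ 0) :
    ∃ L : Matrix (Fin s) (Fin s) K, (∀ i, L i i = 1) ∧ (∀ i j, i < j → L i j = 0) ∧
      ∃ d : Fin s → K, (∀ i, d i ≠ 0) ∧ L * H * (L.map σ)ᵀ = Matrix.diagonal d := by
  obtain ⟨L, hL1, hL, hLH⟩ := H.exists_unitLowerTriangular_mul_upperTriangular hH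
  refine ⟨L, hL1, hL, ?_⟩
  set X := L * H * (L.map σ)ᵀ with hX
  have upper : X.BlockTriangular id := by
    refine Matrix.BlockTriangular.mul (fun i j hij => hLH i j hij) fun i j hij => ?_
    simp [hL j i hij]
  have det_map_L : ((L.map σ).map σ).det = 1 :=
    Matrix.det_eq_one_of_unitLowerTriangular (by simp [hL1])
      fun i j hij => by simp [hL i j hij]
  have unit_map_L : IsUnit ((L.map σ).map σ).det := by rw [det_map_L]; exact isUnit_one
  have map_X : (X.map σ)ᵀ = (L.map σ).map σ * H * (L.map σ)ᵀ := by
    rw [hX, Matrix.map_mul, Matrix.map_mul, Matrix.transpose_mul, Matrix.transpose_mul, hσ,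
      Matrix.transpose_map, Matrix.transpose_transpose, Matrix.mul_assoc]
  have X_eq : X = L * (((L.map σ).map σ)⁻¹ * (X.map σ)ᵀ) := by
    rw [map_X, Matrix.mul_assoc _ H, Matrix.nonsing_inv_mul_cancel_left _ _ unit_map_L, hX,
      Matrix.mul_assoc]
  have lower : X.BlockTriangular OrderDual.toDual := by
    have := Matrix.invertibleOfIsUnitDet _ unit_map_L
    rw [X_eq]
    refine Matrix.BlockTriangular.mul (fun i j hij => hL i j hij)
      (Matrix.BlockTriangular.mul
        (Matrix.blockTriangular_inv_of_blockTriangular fun i j hij => ?_) fun i j hij => ?_)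
    · simp [hL i j hij]
    · simp [upper (i := j) (j := i) hij]
  have X_diag : X = Matrix.diagonal fun i => X i i := by
    ext i j
    rcases lt_trichotomy i j with hij | rfl | hij
    · rw [Matrix.diagonal_apply_ne _ hij.ne]; exact lower hij
    · rw [Matrix.diagonal_apply_eq]
    · rw [Matrix.diagonal_apply_ne _ hij.ne']; exact upper hij
  refine ⟨fun i => X i i, fun i => ?_, X_diag⟩
  have det_X : X.det ≠ 0 := by
    have hdet : H.det ≠ 0 := hH s le_rfl
    rw [hX, Matrix.det_mul, Matrix.det_mul, Matrix.det_transpose,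
      Matrix.det_eq_one_of_unitLowerTriangular hL1 hL,
      Matrix.det_eq_one_of_unitLowerTriangular (L := L.map σ) (by simp [hL1])
        fun i j hij => by simp [hL i j hij]]
    simpa using hdet
  rw [X_diag, Matrix.det_diagonal] at det_X
  exact Finset.prod_ne_zero_iff.mp det_X i (Finset.mem_univ i)

theorem piE_eq_map_iterateFrobenius {K : Type} [Field K] (p e : ℕ) [ExpChar K p] {m n : Type}
    (A : Matrix m n K) : piE p e A = A.map (iterateFrobenius K p e) :=
  rfl

theorem Matrix.mul_permMatrix_mul_transpose_map {K : Type*} [CommRing K] (σ : K →+* K) {n : Type*}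
    [Fintype n] [DecidableEq n] (A : Matrix n n K) (D : n → K) (π : Equiv.Perm n) :
    A * (Matrix.diagonal D * π.permMatrix K) *
        ((A * (Matrix.diagonal D * π.permMatrix K)).map σ)ᵀ =
      A * (Matrix.diagonal D * (Matrix.diagonal D).map σ)ᵀ * (A.map σ)ᵀ := by
  have hP : (π.permMatrix K).map σ = π.permMatrix K := by
    ext i j
    simp [Equiv.Perm.permMatrix, PEquiv.toMatrix_apply, apply_ite σ]
  have hPP : π.permMatrix K * (π.permMatrix K)ᵀ = 1 := by
    rw [Matrix.transpose_permMatrix, ← Matrix.permMatrix_mul]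
    simp
  have hDD : (Matrix.diagonal D).map σ = Matrix.diagonal fun i => σ (D i) :=
    Matrix.diagonal_map (map_zero σ)
  rw [Matrix.map_mul, Matrix.map_mul, hP, hDD, Matrix.transpose_mul, Matrix.transpose_mul,
    Matrix.diagonal_mul_diagonal, Matrix.diagonal_transpose, Matrix.diagonal_transpose,
    ← Matrix.diagonal_mul_diagonal]
  calc _ = A * Matrix.diagonal D * (π.permMatrix K * (π.permMatrix K)ᵀ) *
        Matrix.diagonal (fun i => σ (D i)) * (A.map σ)ᵀ := by simp only [Matrix.mul_assoc]
    _ = _ := by rw [hPP, Matrix.mul_one, Matrix.mul_assoc A]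

theorem pow_pow_eq_self_of_dvd {M : Type*} [Monoid M] {p g k : ℕ} (hgk : g ∣ k) {x : M}
    (hx : x ^ p ^ g = x) : x ^ p ^ k = x := by
  obtain ⟨c, rfl⟩ := hgk
  induction c with
  | zero => simp
  | succ c ih => rw [Nat.mul_succ, pow_add, pow_mul, ih, hx]

/-- construction of NSC quasi-`σ̂` matrices: if `A` is NSC, `M_{τ̃} = D·P` is a
monomial matrix with `A·M_{τ̃}` having all entries in the subfield `F_{p^g}`, and all leading
principal minors of `(A·M_{τ̃})·π_e(A·M_{τ̃})ᵀ` are nonzero, then there is a unit lower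
triangular `L` with `L·A` NSC and `(L·A)·M_{σ̂}ᵀ·π_e(L·A)ᵀ` diagonal with nonzero diagonal,
where `M_{σ̂} = D·π_e(D)`. -/
theorem stmt6 {p h : ℕ} (hp : p.Prime) (hh : 0 < h)
    {F : Type} [Field F] [Fintype F] [DecidableEq F] (hcard : Fintype.card F = p ^ h)
    (e : ℕ) (he : e < h)
    (r g : ℕ) (hr : r = if 2 * e ≤ h then 2 * e else 2 * e - h) (hg : g = Nat.gcd r h)
    {s : ℕ} (A : Matrix (Fin s) (Fin s) F) (hA : IsNSC A)
    (D : Fin s → F) (hD : ∀ i, D i ≠ 0) (π : Equiv.Perm (Fin s))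
    (hsub : ∀ i j, (A * (Matrix.diagonal D * π.permMatrix F)) i j ^ p ^ g
        = (A * (Matrix.diagonal D * π.permMatrix F)) i j)
    (hminors : ∀ (m : ℕ) (hm : m ≤ s),
      (Matrix.of fun a b : Fin m =>
        ((A * (Matrix.diagonal D * π.permMatrix F)) *
          (piE p e (A * (Matrix.diagonal D * π.permMatrix F)))ᵀ)
          (Fin.castLE hm a) (Fin.castLE hm b)).det ≠ 0) :
    ∃ L : Matrix (Fin s) (Fin s) F,
      (∀ i, L i i = 1) ∧ (∀ i j : Fin s, i < j → L i j = 0) ∧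
      IsNSC (L * A) ∧
      ∃ dd : Fin s → F, (∀ i, dd i ≠ 0) ∧
        (L * A) * (Matrix.diagonal D * piE p e (Matrix.diagonal D))ᵀ * (piE p e (L * A))ᵀ =
          Matrix.diagonal dd := by
  have := Fact.mk hp
  have : CharP F p := charP_of_card_eq_prime_pow hcard
  have hg2e : g ∣ 2 * e := by
    have hgr : g ∣ r := hg ▸ Nat.gcd_dvd_left r h
    have hgh : g ∣ h := hg ▸ Nat.gcd_dvd_right r h
    split_ifs at hr with hle
    · exact hr ▸ hgr
    · rw [← Nat.sub_add_cancel (not_le.mp hle).le, ← hr]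
      exact dvd_add hgr hgh
  simp only [piE_eq_map_iterateFrobenius] at hminors ⊢
  set σ := iterateFrobenius F p e with hσ
  set B := A * (Matrix.diagonal D * π.permMatrix F) with hB
  have hσσ : (B.map σ).map σ = B := by
    ext i j
    simp only [Matrix.map_apply, hσ, iterateFrobenius_def]
    rw [← pow_mul, ← pow_add, ← two_mul]
    exact pow_pow_eq_self_of_dvd hg2e (hsub i j)
  obtain ⟨L, hL1, hL, d, hd, hLd⟩ :=
    Matrix.exists_unitLowerTriangular_congr_diagonal σ (B * (B.map σ)ᵀ)
      (by rw [Matrix.map_mul, Matrix.transpose_mul, Matrix.transpose_map,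
        Matrix.transpose_transpose, hσσ]) hminors
  refine ⟨L, hL1, hL, hA.unitLowerTriangular_mul hL1 hL, d, hd, ?_⟩
  rw [← hLd, hB, Matrix.mul_permMatrix_mul_transpose_map, Matrix.map_mul (L := L),
    Matrix.transpose_mul (L.map σ)]
  simp only [Matrix.mul_assoc]
end

section
/- Let 0 ≤ e ≤ h−1 and let A be an s×s non-singular by columns (NSC) Toeplitz matrix over F_q such that π_e(A)·M·A = Q for some s×s monomial matrix M over F_q. Then A·π_e(A)^T = M^{-1}·Q; in particular, A·π_e(A)^T is a monomial matrix, and when e = 0 there exist an s×s diagonal matrix D and an s×s permutation matrix P over F_q with A·A^T = D·P (i.e., A is a τ̃-optimal defining matrix). -/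
open Matrix Finset Kronecker

variable {F : Type} [Field F] [DecidableEq F]

theorem antiDiagQ_apply (F : Type) [Field F] {s : ℕ} (i j : Fin s) :
    antiDiagQ F s i j = if j = i.rev then 1 else 0 := by
  simp only [antiDiagQ, Matrix.of_apply, Fin.ext_iff, Fin.val_rev]
  congr 1
  simp only [eq_iff_iff]
  omega

theorem antiDiagQ_mul_apply {F : Type} [Field F] {s : ℕ} (A : Matrix (Fin s) (Fin s) F)
    (i j : Fin s) : (antiDiagQ F s * A) i j = A i.rev j := by
  simp [Matrix.mul_apply, antiDiagQ_apply]

theorem mul_antiDiagQ_apply {F : Type} [Field F] {s : ℕ} (A : Matrix (Fin s) (Fin s) F)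
    (i j : Fin s) : (A * antiDiagQ F s) i j = A i j.rev := by
  have h : ∀ k : Fin s, j = k.rev ↔ k = j.rev := fun k => by
    rw [eq_comm, Fin.rev_eq_iff]
  simp [Matrix.mul_apply, antiDiagQ_apply, h]

theorem antiDiagQ_mul_self (F : Type) [Field F] (s : ℕ) :
    antiDiagQ F s * antiDiagQ F s = 1 := by
  ext i j
  simp [antiDiagQ_mul_apply, antiDiagQ_apply, Matrix.one_apply, eq_comm]

theorem IsToeplitz.apply_eq_add {F : Type} [Field F] [DecidableEq F] {s : ℕ}
    {A : Matrix (Fin s) (Fin s) F} (hA : IsToeplitz A) (k i j : ℕ) (hi : i + k < s)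
    (hj : j + k < s) :
    A ⟨i, by omega⟩ ⟨j, by omega⟩ = A ⟨i + k, hi⟩ ⟨j + k, hj⟩ := by
  induction k with
  | zero => rfl
  | succ k ih => exact (ih (by omega) (by omega)).trans (hA (i + k) (j + k) hi hj)

/-- Entries of a Toeplitz matrix on a common diagonal agree. -/
theorem IsToeplitz.apply_eq {F : Type} [Field F] [DecidableEq F] {s : ℕ}
    {A : Matrix (Fin s) (Fin s) F} (hA : IsToeplitz A) {i j i' j' : Fin s}
    (h : (i : ℕ) + j' = i' + j) : A i j = A i' j' := by
  obtain ⟨i, hi⟩ := i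
  obtain ⟨j, hj⟩ := j
  obtain ⟨i', hi'⟩ := i'
  obtain ⟨j', hj'⟩ := j'
  simp only at h
  rcases le_total i i' with hle | hle
  · obtain ⟨k, rfl⟩ := Nat.exists_eq_add_of_le hle
    obtain rfl : j' = j + k := by omega
    exact hA.apply_eq_add k i j hi' hj'
  · obtain ⟨k, rfl⟩ := Nat.exists_eq_add_of_le hle
    obtain rfl : j = j' + k := by omega
    exact (hA.apply_eq_add k i' j' hi hj).symm

theorem IsToeplitz.piE {F : Type} [Field F] [DecidableEq F] {s : ℕ}
    {A : Matrix (Fin s) (Fin s) F} (hA : IsToeplitz A) (p e : ℕ) : IsToeplitz (piE p e A) :=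
  fun i j hi hj => congrArg (· ^ p ^ e) (hA i j hi hj)

/-- A Toeplitz matrix is persymmetric. -/
theorem IsToeplitz.antiDiagQ_mul {F : Type} [Field F] [DecidableEq F] {s : ℕ}
    {A : Matrix (Fin s) (Fin s) F} (hA : IsToeplitz A) :
    antiDiagQ F s * A = Aᵀ * antiDiagQ F s := by
  ext i j
  rw [antiDiagQ_mul_apply, mul_antiDiagQ_apply, Matrix.transpose_apply]
  apply hA.apply_eq
  simp only [Fin.val_rev]
  omega

/-- A monomial matrix is the product of an invertible diagonal matrix and a permutation matrix. -/
theorem isMonomial_iff_exists {n F : Type} [Fintype n] [DecidableEq n] [Field F] [DecidableEq F]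
    {M : Matrix n n F} :
    IsMonomial M ↔ ∃ (d : n → F) (σ : Equiv.Perm n), (∀ i, d i ≠ 0) ∧
      M = Matrix.diagonal d * σ.permMatrix F := by
  have entry : ∀ (d : n → F) (σ : Equiv.Perm n) (i j : n),
      (Matrix.diagonal d * σ.permMatrix F) i j = if σ i = j then d i else 0 := by
    intro d σ i j
    simp [Matrix.diagonal_mul, Equiv.Perm.permMatrix, PEquiv.toMatrix_apply, eq_comm]
  constructor
  · rintro ⟨hr, hc⟩
    choose f hf huf using hr
    have hinj : Function.Injective f := fun a b hab =>
      (hc (f a)).unique (hf a) (hab ▸ hf b)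
    refine ⟨fun i => M i (f i), Equiv.ofBijective f (Finite.injective_iff_bijective.mp hinj), hf, ?_⟩
    ext i j
    rw [entry, Equiv.ofBijective_apply]
    split_ifs with h
    · rw [h]
    · by_contra hne
      exact h (huf i j hne).symm
  · rintro ⟨d, σ, hd, rfl⟩
    refine ⟨fun i => ⟨σ i, by simp [entry, hd], fun j hj => ?_⟩,
      fun j => ⟨σ.symm j, by simp [entry, hd], fun i hi => ?_⟩⟩
    · by_contra hne
      exact hj (by simp [entry, Ne.symm hne])
    · by_contra hne
      refine hi ?_
      rw [entry, if_neg]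
      rintro rfl
      simp at hne

theorem IsMonomial.inv {n F : Type} [Fintype n] [DecidableEq n] [Field F] [DecidableEq F]
    {M : Matrix n n F} (hM : IsMonomial M) : IsMonomial M⁻¹ := by
  obtain ⟨d, σ, hd, rfl⟩ := isMonomial_iff_exists.mp hM
  refine isMonomial_iff_exists.mpr ⟨fun i => (d (σ.symm i))⁻¹, σ⁻¹, fun i => inv_ne_zero (hd _), ?_⟩
  apply Matrix.inv_eq_left_inv
  ext i j
  rw [Matrix.mul_apply, Finset.sum_eq_single (σ.symm i)]
  · simp [Matrix.diagonal_mul, Equiv.Perm.permMatrix, PEquiv.toMatrix_apply, Matrix.one_apply,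
      hd]
  · intro k _ hk
    have : ¬ k = σ.symm i := hk
    simp [Matrix.diagonal_mul, Equiv.Perm.permMatrix, PEquiv.toMatrix_apply, Ne.symm this]
  · simp

theorem IsMonomial.mul_antiDiagQ {F : Type} [Field F] [DecidableEq F] {s : ℕ}
    {M : Matrix (Fin s) (Fin s) F} (hM : IsMonomial M) : IsMonomial (M * antiDiagQ F s) := by
  simp only [IsMonomial, mul_antiDiagQ_apply]
  refine ⟨fun i => ?_, fun j => hM.2 j.rev⟩
  exact (Fin.revPerm.existsUnique_congr_left (p := fun j => M i j.rev ≠ 0)).mpr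
    (by simpa using hM.1 i)

/-- if `A` is an NSC Toeplitz matrix with `π_e(A)·M·A = Q` for a monomial `M`,
then `A·π_e(A)ᵀ = M⁻¹·Q` is a monomial matrix, and when `e = 0` there are a diagonal `D` and
a permutation matrix `P` with `A·Aᵀ = D·P` (i.e. `A` is a `τ̃`-optimal defining matrix). -/
theorem stmt12 {p h : ℕ} (hp : p.Prime) (hh : 0 < h)
    {F : Type} [Field F] [Fintype F] [DecidableEq F] (hcard : Fintype.card F = p ^ h)
    (e : ℕ) (he : e < h)
    {s : ℕ} (A : Matrix (Fin s) (Fin s) F) (hA : IsNSC A) (hT : IsToeplitz A)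
    (M : Matrix (Fin s) (Fin s) F) (hM : IsMonomial M)
    (hQ : piE p e A * M * A = antiDiagQ F s) :
    A * (piE p e A)ᵀ = M⁻¹ * antiDiagQ F s ∧
    IsMonomial (A * (piE p e A)ᵀ) ∧
    (e = 0 → ∃ (D : Fin s → F) (π : Equiv.Perm (Fin s)),
      A * Aᵀ = Matrix.diagonal D * π.permMatrix F) := by
  have hB := (hT.piE p e).antiDiagQ_mul
  have hinv : A * antiDiagQ F s * (piE p e A) * M = 1 := by
    rw [mul_assoc _ _ M, mul_eq_one_comm, ← mul_assoc, hQ, antiDiagQ_mul_self]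
  have hmain : A * (piE p e A)ᵀ = M⁻¹ * antiDiagQ F s := by
    rw [Matrix.inv_eq_left_inv hinv, mul_assoc A, hB, mul_assoc A, mul_assoc _ (antiDiagQ F s),
      antiDiagQ_mul_self, mul_one]
  have hmon : IsMonomial (A * (piE p e A)ᵀ) := hmain ▸ hM.inv.mul_antiDiagQ
  refine ⟨hmain, hmon, ?_⟩
  rintro rfl
  obtain ⟨d, σ, -, hd⟩ := isMonomial_iff_exists.mp hmon
  have h0 : piE p 0 A = A := by
    ext i j
    simp [piE]
  exact ⟨d, σ, by rwa [h0] at hd⟩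
end

section
/- Let C ⊆ F_q^n be a linear code, 0 ≤ e ≤ h−1, and M_τ an n×n monomial matrix over F_q; set σ = (M_τ, e) and σ(C) = {π_e(c)·M_τ : c ∈ C}. Then σ(C)^{⊥E} = {σ(x)·(M_τ^T·M_τ)^{-1} : x ∈ C^{⊥E}}, i.e., σ(C)^{⊥E} = σ(C^{⊥E})·(M_τ^T·M_τ)^{-1}. -/
open Matrix Finset Kronecker

variable {F : Type} [Field F] [DecidableEq F]

/-- The entrywise inverse of the transpose is a left inverse of a monomial matrix. -/
theorem IsMonomial.transpose_map_inv_mul {n : Type} [Fintype n] [DecidableEq n]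
    {M : Matrix n n F} (hM : IsMonomial M) : Mᵀ.map (·⁻¹) * M = 1 := by
  ext j k
  rw [Matrix.mul_apply]
  simp only [Matrix.map_apply, Matrix.transpose_apply]
  by_cases hjk : j = k
  · subst hjk
    obtain ⟨i, hi, huniq⟩ := hM.2 j
    rw [Finset.sum_eq_single i, inv_mul_cancel₀ hi, Matrix.one_apply_eq]
    · intro b _ hb
      have hz : M b j = 0 := by
        by_contra hne
        exact hb (huniq b hne)
      simp [hz]
    · simp
  · rw [Matrix.one_apply_ne hjk]
    refine Finset.sum_eq_zero fun i _ => ?_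
    by_contra hne
    obtain ⟨hj, hk⟩ := mul_ne_zero_iff.mp hne
    exact hjk ((hM.1 i).unique (inv_eq_zero.not.mp hj) hk)

theorem IsMonomial.isUnit_det {n : Type} [Fintype n] [DecidableEq n]
    {M : Matrix n n F} (hM : IsMonomial M) : IsUnit M.det :=
  Matrix.isUnit_det_of_left_inverse hM.transpose_map_inv_mul

theorem piEv_surjective {F : Type} [Field F] {p : ℕ} [ExpChar F p] [Finite F]
    (e : ℕ) {n : Type} :
    Function.Surjective (piEv p e : (n → F) → n → F) := by
  intro v
  have hs : Function.Surjective (iterateFrobenius F p e) :=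
    Finite.surjective_of_injective (iterateFrobenius F p e).injective
  choose w hw using fun i => hs (v i)
  exact ⟨w, funext hw⟩

theorem piEv_dotProduct_piEv {F : Type} [Field F] {p : ℕ} [ExpChar F p] (e : ℕ)
    {n : Type} [Fintype n] (x c : n → F) : piEv p e x ⬝ᵥ piEv p e c = (x ⬝ᵥ c) ^ p ^ e := by
  simp only [dotProduct, piEv, ← mul_pow]
  exact (map_sum (iterateFrobenius F p e) _ _).symm

theorem vecMul_mul_inv_transpose_mul_self {F n : Type} [Field F] [Fintype n]
    [DecidableEq n] {M : Matrix n n F} (hM : IsUnit M.det) (v : n → F) :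
    (v ᵥ* M) ᵥ* (Mᵀ * M)⁻¹ = v ᵥ* (Mᵀ)⁻¹ := by
  rw [Matrix.mul_inv_rev, Matrix.vecMul_vecMul, ← Matrix.mul_assoc,
    Matrix.mul_nonsing_inv M hM, Matrix.one_mul]

theorem dotProduct_vecMul_eq {F n : Type} [Field F] [Fintype n] (u v : n → F)
    (M : Matrix n n F) :
    u ⬝ᵥ (v ᵥ* M) = (u ᵥ* Mᵀ) ⬝ᵥ v := by
  rw [Matrix.vecMul_transpose, dotProduct_comm, ← Matrix.dotProduct_mulVec, dotProduct_comm]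

/-- `σ(C)^{⊥E} = σ(C^{⊥E})·(M_τᵀ·M_τ)⁻¹`, where `σ(v) = π_e(v)·M_τ`. -/
theorem stmt15 {p h : ℕ} (hp : p.Prime) (hh : 0 < h)
    {F : Type} [Field F] [Fintype F] [DecidableEq F] (hcard : Fintype.card F = p ^ h)
    {n : ℕ} (C : Submodule F (Fin n → F))
    (e : ℕ) (he : e < h)
    (Mτ : Matrix (Fin n) (Fin n) F) (hMτ : IsMonomial Mτ) :
    {u : Fin n → F |
        ∀ y ∈ (fun c => Matrix.vecMul (piEv p e c) Mτ) '' (C : Set (Fin n → F)),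
          ∑ j, u j * y j = 0} =
      (fun x => Matrix.vecMul x (Mτᵀ * Mτ)⁻¹) ''
        ((fun c => Matrix.vecMul (piEv p e c) Mτ) '' (euclidDual C : Set (Fin n → F))) := by
  have : Fact p.Prime := ⟨hp⟩
  have : CharP F p := charP_of_card_eq_prime_pow hcard
  have hdet : IsUnit Mτ.det := hMτ.isUnit_det
  have hdetT : IsUnit Mτᵀ.det := by rwa [Matrix.det_transpose]
  ext u
  rw [Set.mem_ofPred_eq, Set.forall_mem_image]
  simp only [Set.mem_image, exists_exists_and_eq_and, vecMul_mul_inv_transpose_mul_self hdet]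
  change (∀ c ∈ C, u ⬝ᵥ (piEv p e c ᵥ* Mτ) = 0) ↔
    ∃ x, (∀ c ∈ C, x ⬝ᵥ c = 0) ∧ piEv p e x ᵥ* (Mτᵀ)⁻¹ = u
  simp only [dotProduct_vecMul_eq]
  have hpe : p ^ e ≠ 0 := pow_ne_zero _ hp.ne_zero
  constructor
  · intro hu
    obtain ⟨x, hx⟩ := piEv_surjective (p := p) e (u ᵥ* Mτᵀ)
    refine ⟨x, fun c hc => ?_, ?_⟩
    · rw [← pow_eq_zero_iff hpe, ← piEv_dotProduct_piEv, hx]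
      exact hu c hc
    · rw [hx, Matrix.vecMul_vecMul, Matrix.mul_nonsing_inv _ hdetT, Matrix.vecMul_one]
  · rintro ⟨x, hx, rfl⟩ c hc
    rw [Matrix.vecMul_vecMul, Matrix.nonsing_inv_mul _ hdetT, Matrix.vecMul_one,
      piEv_dotProduct_piEv, hx c hc, zero_pow hpe]
end
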